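/- arXiv:math/0703273 — 2 statements merged into one kernel-verified Lean document; each statement's English description precedes it below -/
import Mathlib

section
/- For every integer n ≥ 1 there exists a constant C = C(n) > 0 such that, setting h(z) = z f_n(z) + 2 f_n'(z), for every m ∈ {0,1,2} and every z ∈ ℝ: if z ≥ 0 then |h^{(m)}(z)| ≤ C (1+z²)^{(m-2^{-n})/2} e^{-z²/4}, and if z ≤ 0 then |h^{(m)}(z)| ≤ C (1+z²)^{-(1+m-2^{-n})/2}. -/
open MeasureTheory Real Filter

/-- `f_n(z) = ∫_z^∞ ξ e^{-ξ²/4} (ξ - z)^{2^{-n} - 1} dξ`. -/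
noncomputable def fn (n : ℕ) (z : ℝ) : ℝ :=
  ∫ ξ in Set.Ioi z, ξ * Real.exp (-ξ^2/4) * (ξ - z) ^ ((2:ℝ)^(-(n:ℝ)) - 1)

lemma poly_bd (p : Polynomial ℝ) :
    ∃ C : ℝ, 0 < C ∧ ∀ x : ℝ, |p.eval x| ≤ C * Real.exp (x^2/8) := by
  induction p using Polynomial.induction_on' with
  | add p q hp hq =>
    obtain ⟨C, hC, h1⟩ := hp
    obtain ⟨D, hD, h2⟩ := hq
    refine ⟨C + D, by positivity, fun x => ?_⟩
    rw [Polynomial.eval_add, add_mul]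
    exact (abs_add_le _ _).trans (add_le_add (h1 x) (h2 x))
  | monomial k c =>
    refine ⟨(|c| + 1) * (1 + 8^k * k.factorial), by positivity, fun x => ?_⟩
    rw [Polynomial.eval_monomial, abs_mul, mul_assoc]
    have h1 := Real.pow_div_factorial_le_exp (x^2/8) (by positivity) k
    have h2 : (1:ℝ) ≤ Real.exp (x^2/8) := Real.one_le_exp (by positivity)
    rw [div_le_iff₀ (by positivity), div_pow, div_le_iff₀ (by positivity)] at h1
    have h3 : |x^k| ≤ 1 + (x^2)^k := by
      have : (x^2)^k = |x^k|^2 := by rw [sq_abs]; ring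
      rw [this]
      nlinarith [sq_nonneg (|x^k| - 1), abs_nonneg (x^k)]
    apply mul_le_mul (by linarith) _ (abs_nonneg _) (by positivity)
    calc |x^k| ≤ _ := h3
      _ ≤ Real.exp (x^2/8) + Real.exp (x^2/8) * k.factorial * 8^k := add_le_add h2 h1
      _ = _ := by ring

noncomputable def FF (a : ℝ) (p : Polynomial ℝ) (z : ℝ) : ℝ :=
  ∫ t in Set.Ioi (0:ℝ), p.eval (z+t) * Real.exp (-(z+t)^2/4) * t^(a-1)

noncomputable def dd (p : Polynomial ℝ) : Polynomial ℝ :=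
  p.derivative - Polynomial.C (1/2) * Polynomial.X * p

lemma dd_hasDeriv (p : Polynomial ℝ) (x : ℝ) :
    HasDerivAt (fun x => p.eval x * Real.exp (-x^2/4)) ((dd p).eval x * Real.exp (-x^2/4)) x := by
  have h1 := p.hasDerivAt x
  have h2 : HasDerivAt (fun x : ℝ => -x^2/4) (-(2*x)/4) x := by
    have := ((hasDerivAt_pow 2 x).neg).div_const 4
    simpa using this
  refine (h1.mul h2.exp).congr_deriv ?_
  simp [dd]
  ring

lemma gauss_int {a : ℝ} (ha : 0 < a) (z : ℝ) {c : ℝ} (hc : 0 < c) :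
    IntegrableOn (fun t => Real.exp (-(c*(z+t)^2)) * t^(a-1)) (Set.Ioi 0) := by
  have h := (Real.GammaIntegral_convergent ha).const_mul (Real.exp (1/(4*c) - z))
  refine Integrable.mono' h ?_ ?_
  · exact Measurable.aestronglyMeasurable (by fun_prop)
  · filter_upwards [ae_restrict_mem measurableSet_Ioi] with t ht
    have ht : 0 < t := ht
    rw [Real.norm_eq_abs, abs_of_nonneg (by positivity), ← mul_assoc, ← Real.exp_add]
    gcongr
    have : c*(z+t)^2 - (z+t) + 1/(4*c) = c * ((z+t) - 1/(2*c))^2 := by field_simp; ring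
    nlinarith [mul_nonneg hc.le (sq_nonneg ((z+t) - 1/(2*c)))]

lemma FF_meas (a : ℝ) (p : Polynomial ℝ) (z : ℝ) :
    Measurable (fun t : ℝ => p.eval (z+t) * Real.exp (-(z+t)^2/4) * t^(a-1)) := by
  have : Measurable (fun t : ℝ => p.eval (z+t)) := 
    (p.continuous.comp (continuous_const.add continuous_id)).measurable
  fun_prop

lemma FF_pt (p : Polynomial ℝ) : ∃ C : ℝ, 0 < C ∧ ∀ a x t : ℝ, 0 < t →
    ‖p.eval x * Real.exp (-x^2/4) * t^(a-1)‖ ≤ C * (Real.exp (-(1/8*x^2)) * t^(a-1)) := by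
  obtain ⟨C, hC, h⟩ := poly_bd p
  refine ⟨C, hC, fun a x t ht => ?_⟩
  rw [Real.norm_eq_abs, abs_mul, abs_mul, Real.abs_exp, abs_of_pos (Real.rpow_pos_of_pos ht _),
    ← mul_assoc]
  refine mul_le_mul_of_nonneg_right ?_ (Real.rpow_pos_of_pos ht _).le
  calc _ ≤ C * Real.exp (x^2/8) * Real.exp (-x^2/4) := by gcongr; exact h x
    _ = _ := by rw [mul_assoc, ← Real.exp_add]; congr 2; ring

lemma FF_int {a : ℝ} (ha : 0 < a) (p : Polynomial ℝ) (z : ℝ) :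
    IntegrableOn (fun t => p.eval (z+t) * Real.exp (-(z+t)^2/4) * t^(a-1)) (Set.Ioi 0) := by
  obtain ⟨C, hC, h⟩ := FF_pt p
  refine Integrable.mono' ((gauss_int ha z (c := 1/8) (by norm_num)).const_mul C)
    (FF_meas a p z).aestronglyMeasurable ?_
  filter_upwards [ae_restrict_mem measurableSet_Ioi] with t ht
  exact h a _ t ht

lemma FF_deriv {a : ℝ} (ha : 0 < a) (p : Polynomial ℝ) (z : ℝ) :
    HasDerivAt (FF a p) (FF a (dd p) z) z := by
  obtain ⟨C, hC, h⟩ := FF_pt (dd p)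
  have hb := ((gauss_int ha z (c := 1/16) (by norm_num)).const_mul (C * Real.exp 1))
  refine (hasDerivAt_integral_of_dominated_loc_of_deriv_le (μ := volume.restrict (Set.Ioi 0))
    (F := fun z t => p.eval (z+t) * Real.exp (-(z+t)^2/4) * t^(a-1))
    (F' := fun z t => (dd p).eval (z+t) * Real.exp (-(z+t)^2/4) * t^(a-1))
    (Metric.ball_mem_nhds z one_pos) (Eventually.of_forall fun y => ?_) (FF_int ha p z)
    (FF_meas a (dd p) z).aestronglyMeasurable ?_ hb ?_).2
  · exact (FF_meas a p y).aestronglyMeasurable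
  · filter_upwards [ae_restrict_mem measurableSet_Ioi] with t ht y hy
    have ht : 0 < t := ht
    refine (h a _ t ht).trans ?_
    rw [mul_assoc C, ← mul_assoc (Real.exp 1), ← Real.exp_add]
    gcongr
    rw [Metric.mem_ball, Real.dist_eq, abs_lt] at hy
    nlinarith [sq_nonneg ((y+t) + (y - z))]
  · filter_upwards with t y hy
    have := (dd_hasDeriv p (y+t)).comp_add_const y t
    exact this.mul_const _

lemma fn_eq (n : ℕ) (z : ℝ) : fn n z = FF ((2:ℝ)^(-(n:ℝ))) Polynomial.X z := by
  unfold fn FF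
  have h1 : MeasurePreserving (fun t : ℝ => z + t) volume volume := measurePreserving_add_left volume z
  have h2 : MeasurableEmbedding (fun t : ℝ => z + t) := measurableEmbedding_addLeft z
  rw [← h1.setIntegral_preimage_emb h2]
  simp

lemma FF_smul (a c : ℝ) (p : Polynomial ℝ) (z : ℝ) :
    FF a (Polynomial.C c * p) z = c * FF a p z := by
  unfold FF
  rw [← integral_const_mul]
  congr 1; ext t
  simp; ring

lemma FF_parts {a : ℝ} (ha : 0 < a) (z : ℝ) :
    z * FF a (dd 1) z + (1 - a) * FF a 1 z + 2 * FF a (dd (dd 1)) z = 0 := by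
  have i0 := FF_int ha 1 z
  have i1 := FF_int ha (dd 1) z
  have i2 := FF_int ha (dd (dd 1)) z
  have key := integral_Ioi_of_hasDerivAt_of_tendsto (a := 0) (m := 0)
    (f := fun t : ℝ => -(t^a * Real.exp (-(z+t)^2/4)))
    (f' := fun t : ℝ => z * ((dd 1).eval (z+t) * Real.exp (-(z+t)^2/4) * t^(a-1)) +
      (1-a) * ((1 : Polynomial ℝ).eval (z+t) * Real.exp (-(z+t)^2/4) * t^(a-1)) +
      2 * ((dd (dd 1)).eval (z+t) * Real.exp (-(z+t)^2/4) * t^(a-1))) ?_ ?_ ?_ ?_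
  · have i3 : IntegrableOn (fun t : ℝ => z * ((dd 1).eval (z+t) * Real.exp (-(z+t)^2/4) * t^(a-1)) +
      (1-a) * ((1 : Polynomial ℝ).eval (z+t) * Real.exp (-(z+t)^2/4) * t^(a-1))) (Set.Ioi 0) :=
      (i1.const_mul z).add (i0.const_mul _)
    rw [integral_add i3 (i2.const_mul _),
      integral_add (i1.const_mul z) (i0.const_mul _), integral_const_mul, integral_const_mul,
      integral_const_mul] at key
    unfold FF
    rw [key]
    simp [ha.ne']
  · apply Continuous.continuousWithinAt
    have : Continuous (fun t : ℝ => t^a) := Real.continuous_rpow_const ha.le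
    fun_prop
  · intro t ht
    have ht : 0 < t := ht
    have h1 := Real.hasDerivAt_rpow_const (x := t) (p := a) (Or.inl ht.ne')
    have h2 : HasDerivAt (fun t : ℝ => Real.exp (-(z+t)^2/4)) 
        ((dd 1).eval (z+t) * Real.exp (-(z+t)^2/4)) t := by
      have := (dd_hasDeriv 1 (z+t)).comp_const_add z t
      simpa using this
    refine ((h1.mul h2).neg).congr_deriv ?_
    have : t^a = t * t^(a-1) := by rw [Real.rpow_sub_one ht.ne']; field_simp
    rw [this]
    simp [dd]
    ring
  · exact ((i1.const_mul z).add (i0.const_mul _)).add (i2.const_mul _)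
  · rw [← neg_zero]
    apply Tendsto.neg
    have h := (tendsto_rpow_mul_exp_neg_mul_atTop_nhds_zero a 1 one_pos).const_mul (Real.exp (1 - z))
    rw [mul_zero] at h
    refine squeeze_zero' ?_ ?_ h
    · filter_upwards [eventually_ge_atTop 0] with t ht
      positivity
    · filter_upwards [eventually_ge_atTop 0] with t ht
      rw [mul_left_comm, ← Real.exp_add]
      gcongr
      nlinarith [sq_nonneg ((z+t) - 2)]

lemma triv_bd {a : ℝ} (ha : 0 < a) (ha1 : a < 1) (p : Polynomial ℝ) :
    ∃ C : ℝ, 0 < C ∧ ∀ z : ℝ, |FF a p z| ≤ C * (√(1+z^2))^(a-1) := by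
  obtain ⟨C, hC, h⟩ := poly_bd ((2 + Polynomial.X^2) * p)
  have hG := Real.GammaIntegral_convergent ha
  have hg : Integrable (fun t : ℝ => Real.exp (-(1/8) * t^2)) :=
    integrable_exp_neg_mul_sq (by norm_num)
  refine ⟨2 * C * ((∫ t : ℝ, Real.exp (-(1/8) * t^2)) + Real.exp 1 * Real.Gamma a),
    ?_, fun z => ?_⟩
  · have := Real.Gamma_pos_of_pos ha
    have : 0 ≤ ∫ t : ℝ, Real.exp (-(1/8) * t^2) := integral_nonneg fun t => by positivity
    positivity
  set j := √(1+z^2) with hj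
  have hj2 : j^2 = 1 + z^2 := Real.sq_sqrt (by positivity)
  have hj0 : 0 < j := Real.sqrt_pos.2 (by positivity)
  have hgz := (hg.comp_add_left z).integrableOn (s := Set.Ioi 0)
  have hint := (hgz.add (hG.const_mul (Real.exp 1))).const_mul (2 * C * j^(a-1))
  have := norm_integral_le_of_norm_le (μ := volume.restrict (Set.Ioi 0))
    (f := fun t => p.eval (z+t) * Real.exp (-(z+t)^2/4) * t^(a-1)) hint ?_
  · rw [integral_const_mul] at this
    simp only [Pi.add_apply] at this
    rw [integral_add hgz (hG.const_mul (Real.exp 1)), integral_const_mul,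
      ← Real.Gamma_eq_integral ha] at this
    unfold FF
    refine this.trans ?_
    have h3 : ∫ t in Set.Ioi (0:ℝ), Real.exp (-(1/8) * (z+t)^2) ≤ ∫ t : ℝ, Real.exp (-(1/8) * t^2) := by
      refine (setIntegral_le_integral (hg.comp_add_left z)
        (Eventually.of_forall fun t => by positivity)).trans_eq ?_
      exact integral_add_left_eq_self (fun t : ℝ => Real.exp (-(1/8) * t^2)) z
    calc _ ≤ 2 * C * j^(a-1) * ((∫ t : ℝ, Real.exp (-(1/8) * t^2)) + Real.exp 1 * Real.Gamma a) := by
          gcongr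
      _ = _ := by ring
  · filter_upwards [ae_restrict_mem measurableSet_Ioi] with t ht
    have ht : 0 < t := ht
    simp only [Pi.add_apply]
    rw [Real.norm_eq_abs, abs_mul, abs_mul, Real.abs_exp, abs_of_pos (Real.rpow_pos_of_pos ht _)]
    set x := z + t with hx
    have hx1 := h x
    simp only [Polynomial.eval_mul, Polynomial.eval_add, Polynomial.eval_pow, Polynomial.eval_X,
      Polynomial.eval_ofNat, abs_mul] at hx1
    rw [abs_of_pos (by positivity : 0 < 2 + x^2)] at hx1
    have hj1 : j ≤ (1+t) * (1+|x|) := by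
      have h1 : j ≤ 1 + |z| := by
        apply abs_le_of_sq_le_sq' _ (by positivity) |>.2
        rw [hj2]
        nlinarith [abs_nonneg z, sq_abs z]
      have h2 : |z| ≤ |x| + t := by
        have : z = x - t := by rw [hx]; ring
        rw [this]
        refine (abs_sub _ _).trans_eq ?_
        rw [abs_of_pos ht]
      nlinarith [abs_nonneg x, mul_nonneg ht.le (abs_nonneg x)]
    have hA : 1 ≤ j^(a-1) * ((1+t)^(1-a) * (2 + x^2)) := by
      have h1 : j^(1-a) ≤ (1+t)^(1-a) * (2+x^2) := by
        calc j^(1-a) ≤ ((1+t) * (1+|x|))^(1-a) := Real.rpow_le_rpow hj0.le hj1 (by linarith)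
          _ = (1+t)^(1-a) * (1+|x|)^(1-a) := Real.mul_rpow (by positivity) (by positivity)
          _ ≤ (1+t)^(1-a) * (1+|x|) := by
            gcongr
            exact Real.rpow_le_self_of_one_le (by linarith [abs_nonneg x]) (by linarith)
          _ ≤ _ := by
            refine mul_le_mul_of_nonneg_left ?_ (by positivity)
            nlinarith [sq_abs x, sq_nonneg (|x| - 1)]
      have h2 : j^(a-1) * j^(1-a) = 1 := by
        rw [← Real.rpow_add hj0]; simp
      exact h2.symm.le.trans (mul_le_mul_of_nonneg_left h1 (by positivity))
    have hB : (1+t)^(1-a) * t^(a-1) ≤ 2 * (1 + Real.exp 1 * (Real.exp (-t) * t^(a-1))) := by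
      rcases le_total 1 t with h1 | h1
      · have : (1+t)^(1-a) ≤ 2 * t^(1-a) := by
          calc (1+t)^(1-a) ≤ (2*t)^(1-a) := Real.rpow_le_rpow (by positivity) (by linarith) (by linarith)
            _ = 2^(1-a) * t^(1-a) := Real.mul_rpow (by positivity) (by positivity)
            _ ≤ _ := by
              gcongr
              exact Real.rpow_le_self_of_one_le (by norm_num) (by linarith)
        have h2 : t^(1-a) * t^(a-1) = 1 := by
          rw [← Real.rpow_add ht]; simp
        calc _ ≤ 2 * t^(1-a) * t^(a-1) := by gcongr
          _ = 2 * 1 := by rw [mul_assoc, h2]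
          _ ≤ _ := by
            gcongr
            have : 0 ≤ Real.exp 1 * (Real.exp (-t) * t^(a-1)) := by positivity
            linarith
      · have h2 : (1+t)^(1-a) ≤ 2 :=
          (Real.rpow_le_self_of_one_le (by linarith) (by linarith)).trans (by linarith)
        calc _ ≤ 2 * t^(a-1) := by gcongr
          _ ≤ _ := by
            gcongr
            rw [← mul_assoc, ← Real.exp_add]
            have : 1 ≤ Real.exp (1 + -t) := Real.one_le_exp (by linarith)
            nlinarith [Real.rpow_pos_of_pos ht (a-1)]
    have hE : Real.exp (x^2/8) * Real.exp (-x^2/4) = Real.exp (-(1/8)*x^2) := by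
      rw [← Real.exp_add]; congr 1; ring
    have hE1 : Real.exp (-(1/8)*x^2) ≤ 1 := Real.exp_le_one_iff.2 (by nlinarith [sq_nonneg x])
    have hT := Real.rpow_pos_of_pos ht (a-1)
    have hJ := Real.rpow_pos_of_pos hj0 (a-1)
    calc |p.eval x| * Real.exp (-x^2/4) * t^(a-1)
        ≤ (j^(a-1) * ((1+t)^(1-a) * (2 + x^2))) * (|p.eval x| * Real.exp (-x^2/4) * t^(a-1)) :=
          le_mul_of_one_le_left (by positivity) hA
      _ = j^(a-1) * ((1+t)^(1-a) * t^(a-1)) * (((2 + x^2) * |p.eval x|) * Real.exp (-x^2/4)) := by ring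
      _ ≤ j^(a-1) * (2 * (1 + Real.exp 1 * (Real.exp (-t) * t^(a-1)))) *
          ((C * Real.exp (x^2/8)) * Real.exp (-x^2/4)) := by gcongr
      _ = 2 * C * j^(a-1) * (Real.exp (-(1/8)*x^2) +
            Real.exp (-(1/8)*x^2) * (Real.exp 1 * (Real.exp (-t) * t^(a-1)))) := by
          rw [mul_assoc C, hE]; ring
      _ ≤ _ := by
          refine mul_le_mul_of_nonneg_left ?_ (by positivity)
          refine add_le_add le_rfl ?_
          exact mul_le_of_le_one_left (by positivity) hE1

lemma pos_bd {a : ℝ} (ha : 0 < a) (p : Polynomial ℝ) (z L : ℝ) (hz : 0 ≤ z) (hL : 0 ≤ L)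
    (hp : ∀ t : ℝ, 0 < t → |p.eval (z+t)| ≤ L * (1+t)) :
    |FF a p z| ≤ (Real.exp (9/4) * 2^a * Real.Gamma a) * (L * (√(1+z^2))^(-a)) *
      Real.exp (-z^2/4) := by
  set j := √(1+z^2) with hj
  have hj2 : j^2 = 1 + z^2 := Real.sq_sqrt (by positivity)
  have hj0 : 0 < j := Real.sqrt_pos.2 (by positivity)
  have hG := Real.Gamma_pos_of_pos ha
  have hv := Real.integral_rpow_mul_exp_neg_mul_Ioi ha (r := (1+z)/2) (by positivity)
  have hi : IntegrableOn (fun t : ℝ => t^(a-1) * Real.exp (-((1+z)/2*t))) (Set.Ioi 0) := by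
    by_contra hcon
    rw [integral_undef hcon] at hv
    have : 0 < (1 / ((1 + z) / 2)) ^ a * Real.Gamma a := by positivity
    linarith
  have := norm_integral_le_of_norm_le (μ := volume.restrict (Set.Ioi 0))
    (f := fun t => p.eval (z+t) * Real.exp (-(z+t)^2/4) * t^(a-1))
    (hi.const_mul (Real.exp (9/4) * L * Real.exp (-z^2/4))) ?_
  · rw [integral_const_mul, hv] at this
    unfold FF
    refine this.trans ?_
    have h1 : j ≤ 1 + z := by
      apply abs_le_of_sq_le_sq' _ (by positivity) |>.2
      rw [hj2]; nlinarith
    have h2 : (1/((1+z)/2))^a ≤ 2^a * j^(-a) := by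
      rw [one_div_div, Real.div_rpow (by positivity) (by positivity), Real.rpow_neg hj0.le,
        ← div_eq_mul_inv]
      gcongr
    calc _ ≤ Real.exp (9/4) * L * Real.exp (-z^2/4) * (2^a * j^(-a) * Real.Gamma a) := by gcongr
      _ = _ := by ring
  · filter_upwards [ae_restrict_mem measurableSet_Ioi] with t ht
    have ht : 0 < t := ht
    rw [Real.norm_eq_abs, abs_mul, abs_mul, Real.abs_exp, abs_of_pos (Real.rpow_pos_of_pos ht _)]
    have h1 : 1 + t ≤ Real.exp t := by linarith [Real.add_one_le_exp t]
    have hT := Real.rpow_pos_of_pos ht (a-1)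
    calc _ ≤ L * Real.exp t * Real.exp (-(z+t)^2/4) * t^(a-1) := by
            gcongr
            exact (hp t ht).trans (by gcongr)
      _ = L * (Real.exp t * Real.exp (-(z+t)^2/4)) * t^(a-1) := by ring
      _ ≤ L * (Real.exp (9/4) * Real.exp (-z^2/4) * Real.exp (-((1+z)/2*t))) * t^(a-1) := by
            refine mul_le_mul_of_nonneg_right (mul_le_mul_of_nonneg_left ?_ hL) hT.le
            rw [← Real.exp_add, ← Real.exp_add, ← Real.exp_add]
            apply Real.exp_le_exp.2
            nlinarith [sq_nonneg (t - 3)]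
      _ = _ := by ring

lemma FF_X (a z : ℝ) : FF a Polynomial.X z = -2 * FF a (dd 1) z := by
  rw [← FF_smul]
  congr 1
  simp only [dd, Polynomial.derivative_one, zero_sub, mul_one, mul_neg, ← mul_assoc,
    ← Polynomial.C_mul]
  norm_num

lemma rpow_half (z s : ℝ) : (1+z^2)^(s/2) = (√(1+z^2))^s := by
  rw [Real.sqrt_eq_rpow, ← Real.rpow_mul (by positivity)]
  congr 1; ring

set_option maxHeartbeats 2000000 in
theorem stmt_5 (n : ℕ) (hn : 1 ≤ n) :
    ∃ C : ℝ, 0 < C ∧ ∀ m : ℕ, m ≤ 2 → ∀ z : ℝ,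
      (0 ≤ z → |iteratedDeriv m (fun y => y * fn n y + 2 * deriv (fn n) y) z| ≤
        C * (1 + z^2) ^ (((m:ℝ) - (2:ℝ)^(-(n:ℝ))) / 2) * Real.exp (-z^2/4)) ∧
      (z ≤ 0 → |iteratedDeriv m (fun y => y * fn n y + 2 * deriv (fn n) y) z| ≤
        C * (1 + z^2) ^ (-((1 + (m:ℝ) - (2:ℝ)^(-(n:ℝ))) / 2))) := by
  have hfn : fn n = fun z => -2 * FF ((2:ℝ)^(-(n:ℝ))) (dd 1) z := by
    ext z; rw [fn_eq, FF_X]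
  have ha : 0 < (2:ℝ)^(-(n:ℝ)) := by positivity
  have ha1 : (2:ℝ)^(-(n:ℝ)) < 1 := by
    apply Real.rpow_lt_one_of_one_lt_of_neg (by norm_num)
    have : (1:ℝ) ≤ n := by exact_mod_cast hn
    linarith
  rw [hfn]
  generalize (2:ℝ)^(-(n:ℝ)) = a at *
  have d0 := FF_deriv ha 1
  have d1 := FF_deriv ha (dd 1)
  have d2 := FF_deriv ha (dd (dd 1))
  have d3 := FF_deriv ha (dd (dd (dd 1)))
  have e0 := fun z => FF_parts ha z
  obtain ⟨C0, hC0, b0⟩ := triv_bd ha ha1 1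
  obtain ⟨C1, hC1, b1⟩ := triv_bd ha ha1 (dd 1)
  obtain ⟨C2, hC2, b2⟩ := triv_bd ha ha1 (dd (dd 1))
  obtain ⟨C3, hC3, b3⟩ := triv_bd ha ha1 (dd (dd (dd 1)))
  obtain ⟨C4, hC4, b4⟩ := triv_bd ha ha1 (dd (dd (dd (dd 1))))
  have p0 : ∀ z : ℝ, 0 ≤ z → _ := fun z hz => pos_bd ha 1 z 1 hz zero_le_one
    (fun t ht => by simp; exact ht.le)
  have p1 : ∀ z : ℝ, 0 ≤ z → _ := fun z hz => pos_bd ha (dd 1) z (√(1+z^2)) hz (by positivity)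
    (fun t ht => by
      have hj2 : (√(1+z^2))^2 = 1 + z^2 := Real.sq_sqrt (by positivity)
      have hj0 : 0 ≤ √(1+z^2) := by positivity
      have hj1 : 1 ≤ √(1+z^2) := by nlinarith
      have hjz : z ≤ √(1+z^2) := by nlinarith
      simp only [dd, Polynomial.derivative_one, zero_sub, mul_one, Polynomial.eval_neg,
        Polynomial.eval_mul, Polynomial.eval_C, Polynomial.eval_X, abs_neg]
      rw [abs_of_nonneg (by positivity)]
      nlinarith)
  set H0 := FF a 1
  set H1 := FF a (dd 1)
  set H2 := FF a (dd (dd 1))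
  set H3 := FF a (dd (dd (dd 1)))
  set H4 := FF a (dd (dd (dd (dd 1))))
  have e1 : ∀ z, z * H2 z + (2 - a) * H1 z + 2 * H3 z = 0 := fun z => by
    have h := ((((hasDerivAt_id z).mul (d1 z)).add ((d0 z).const_mul (1-a))).add
      ((d2 z).const_mul 2))
    have h' : HasDerivAt (fun _ : ℝ => (0:ℝ)) _ z := h.congr_of_eventuallyEq
      (Eventually.of_forall fun y => (e0 y).symm)
    have := h'.unique (hasDerivAt_const z 0)
    simp only [id] at this
    linarith
  have e2 : ∀ z, z * H3 z + (3 - a) * H2 z + 2 * H4 z = 0 := fun z => by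
    have h := ((((hasDerivAt_id z).mul (d2 z)).add ((d1 z).const_mul (2-a))).add
      ((d3 z).const_mul 2))
    have h' : HasDerivAt (fun _ : ℝ => (0:ℝ)) _ z := h.congr_of_eventuallyEq
      (Eventually.of_forall fun y => (e1 y).symm)
    have := h'.unique (hasDerivAt_const z 0)
    simp only [id] at this
    linarith
  have hh : (fun y => y * (fun z => -2 * H1 z) y + 2 * deriv (fun z => -2 * H1 z) y) =
      fun y => 2 * (1 - a) * H0 y := by
    ext y
    rw [((d1 y).const_mul (-2)).deriv]
    linarith [e0 y]
  rw [hh]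
  have i1 : deriv (fun y => 2 * (1 - a) * H0 y) = fun y => 2 * (1 - a) * H1 y := by
    ext y; exact ((d0 y).const_mul _).deriv
  have i2 : deriv (fun y => 2 * (1 - a) * H1 y) = fun y => 2 * (1 - a) * H2 y := by
    ext y; exact ((d1 y).const_mul _).deriv
  clear_value H0 H1 H2 H3 H4
  set K := Real.exp (9/4) * 2^a * Real.Gamma a
  have hK : 0 < K := by have := Real.Gamma_pos_of_pos ha; positivity
  clear_value K
  set D := C0 + C1 + C2 + C3 + C4 with hD
  have hD0 : 0 < D := by positivity
  have main : ∀ z : ℝ, 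
      (0 ≤ z → 
        |H0 z| ≤ K * (√(1+z^2))^(0 - a) * Real.exp (-z^2/4) ∧
        |H1 z| ≤ K * (√(1+z^2))^(1 - a) * Real.exp (-z^2/4) ∧
        |H2 z| ≤ K * (√(1+z^2))^(2 - a) * Real.exp (-z^2/4)) ∧
      (z ≤ 0 → 
        |H0 z| ≤ 25 * D * (√(1+z^2))^(-(1 + 0 - a)) ∧
        |H1 z| ≤ 25 * D * (√(1+z^2))^(-(1 + 1 - a)) ∧
        |H2 z| ≤ 25 * D * (√(1+z^2))^(-(1 + 2 - a))) := by
    intro z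
    specialize e0 z
    specialize e1 z
    specialize e2 z
    specialize b0 z
    specialize b1 z
    specialize b2 z
    specialize b3 z
    specialize b4 z
    specialize p0 z
    specialize p1 z
    have hj2 : (√(1+z^2))^2 = 1 + z^2 := Real.sq_sqrt (by positivity)
    have hj0 : 0 < √(1+z^2) := by positivity
    set j := √(1+z^2)
    clear_value j
    have hj1 : 1 ≤ j := by nlinarith
    have hjz : |z| ≤ j := by
      apply abs_le_of_sq_le_sq _ hj0.le
      linarith
    have hjz' : j ≤ 1 + |z| := by
      apply (abs_le_of_sq_le_sq' _ (by positivity)).2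
      nlinarith [sq_abs z, abs_nonneg z]
    constructor
    · intro hz
      have q0 := p0 hz
      have q1 := p1 hz
      have r1 : j^(1-a) = j * j^(-a) := by
        rw [sub_eq_add_neg, Real.rpow_add hj0, Real.rpow_one]
      have r2 : j^(2-a) = j^2 * j^(-a) := by
        rw [sub_eq_add_neg, Real.rpow_add hj0, Real.rpow_two]
      rw [r1, r2, zero_sub]
      rw [one_mul] at q0
      refine ⟨q0, q1, ?_⟩
      have hJ := Real.rpow_pos_of_pos hj0 (-a)
      have hE := Real.exp_pos (-z^2/4)
      set E := Real.exp (-z^2/4)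
      set J := j^(-a)
      have h2 : H2 z = -(z/2 * H1 z) - (1-a)/2 * H0 z := by linarith
      rw [abs_of_nonneg hz] at hjz
      calc |H2 z| ≤ z/2 * |H1 z| + (1-a)/2 * |H0 z| := by
            rw [h2]
            refine (abs_sub _ _).trans_eq ?_
            rw [abs_neg, abs_mul, abs_mul, abs_of_nonneg (by linarith : 0 ≤ z/2),
              abs_of_nonneg (by linarith : 0 ≤ (1-a)/2)]
        _ ≤ j/2 * (K * (j * J) * E) + 1/2 * (K * J * E) := by
            gcongr
            linarith
        _ = (j^2 + 1)/2 * (K * J * E) := by ring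
        _ ≤ j^2 * (K * J * E) := by
            apply mul_le_mul_of_nonneg_right _ (by positivity)
            nlinarith
        _ = _ := by ring
    · intro hz
      have hJ := Real.rpow_pos_of_pos hj0 (a-1)
      have r0 : j^(-(1+0-a)) = j^(a-1) := by congr 1; ring
      have r1 : j^(-(1+1-a)) = j^(a-1) / j := by
        rw [← Real.rpow_sub_one hj0.ne']; congr 1; ring
      have r2 : j^(-(1+2-a)) = j^(a-1) / j^2 := by
        rw [← Real.rpow_two, ← Real.rpow_sub hj0]; congr 1; ring
      rw [r0, r1, r2]
      set J := j^(a-1)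
      clear_value J
      have c0 : |H0 z| ≤ D * J := b0.trans (by gcongr; linarith)
      have c1 : |H1 z| ≤ D * J := b1.trans (by gcongr; linarith)
      have c2 : |H2 z| ≤ D * J := b2.trans (by gcongr; linarith)
      have c3 : |H3 z| ≤ D * J := b3.trans (by gcongr; linarith)
      have c4 : |H4 z| ≤ D * J := b4.trans (by gcongr; linarith)
      have gen : ∀ c u v w : ℝ, 0 ≤ c → z * v + (c - a) * u + 2 * w = 0 → a ≤ c →
          j * |v| ≤ |v| + c * |u| + 2 * |w| := by
        intro c u v w hc he hac
        have h1 : |z| * |v| ≤ c * |u| + 2 * |w| := by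
          rw [← abs_mul, show z * v = -((c-a)*u) - 2 * w by linarith]
          refine (abs_sub _ _).trans ?_
          rw [abs_neg, abs_mul, abs_mul, abs_of_nonneg (by linarith : 0 ≤ c-a), abs_two]
          gcongr
          linarith
        have h2 : j * |v| ≤ (1 + |z|) * |v| := mul_le_mul_of_nonneg_right hjz' (abs_nonneg v)
        rw [add_mul, one_mul] at h2
        linarith only [h1, h2]
      have g1 := gen 1 _ _ _ (by norm_num) e0 (by linarith)
      have g2 := gen 2 _ _ _ (by norm_num) e1 (by linarith)
      have g3 := gen 3 _ _ _ (by norm_num) e2 (by linarith)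
      have hDJ : 0 < D * J := by positivity
      refine ⟨by linarith, ?_, ?_⟩
      · rw [mul_div_assoc', le_div_iff₀ hj0]
        linarith
      · rw [mul_div_assoc', le_div_iff₀ (by positivity)]
        have : j * (j * |H2 z|) ≤ j * (|H2 z| + 2 * |H1 z| + 2 * |H3 z|) := by gcongr
        linarith
  have hfin : ∀ (H : ℝ → ℝ) (z B R : ℝ), 0 ≤ R → 0 ≤ B → B ≤ K + 25 * D → |H z| ≤ B * R →
      |2 * (1-a) * H z| ≤ 2 * (K + 25 * D) * R := by
    intro H z B R hR hB hBK h
    rw [abs_mul, abs_of_nonneg (by linarith : 0 ≤ 2 * (1-a)), mul_assoc 2 (K + _)]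
    have : |H z| ≤ (K + 25 * D) * R := h.trans (by gcongr)
    calc 2 * (1-a) * |H z| ≤ 2 * 1 * |H z| := by gcongr; linarith
      _ ≤ _ := by linarith
  refine ⟨2 * (K + 25 * D), by positivity, fun m hm z => ?_⟩
  obtain ⟨mp, mn⟩ := main z
  rw [rpow_half, ← neg_div, rpow_half]
  have hj0 : 0 < √(1+z^2) := by positivity
  constructor
  · intro hz
    obtain ⟨q0, q1, q2⟩ := mp hz
    rw [mul_assoc (2 * _)]
    rw [mul_assoc] at q0 q1 q2
    interval_cases m
    · simpa using hfin H0 z K _ (by positivity) hK.le (by linarith) q0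
    · rw [iteratedDeriv_one, i1]
      simpa using hfin H1 z K _ (by positivity) hK.le (by linarith) q1
    · rw [iteratedDeriv_succ, iteratedDeriv_one, i1, i2]
      simpa using hfin H2 z K _ (by positivity) hK.le (by linarith) q2
  · intro hz
    obtain ⟨q0, q1, q2⟩ := mn hz
    interval_cases m
    · simpa using hfin H0 z _ _ (by positivity) (by positivity) (by linarith) q0
    · rw [iteratedDeriv_one, i1]
      simpa using hfin H1 z _ _ (by positivity) (by positivity) (by linarith) q1
    · rw [iteratedDeriv_succ, iteratedDeriv_one, i1, i2]
      simpa using hfin H2 z _ _ (by positivity) (by positivity) (by linarith) q2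
end

section
/- There exist constants δ > 0 and C > 0 such that for all real α, γ with γ ≠ 0 and |αγ| ≤ δ, the Burgers profile g_0 satisfies sup_{z ∈ ℝ} Σ_{m=0}^{3} e^{z²/4} (1+z²)^{-m/2} |g_0^{(m)}(z)| ≤ C |α|; that is, for m = 0,1,2,3 and all z, |g_0^{(m)}(z)| ≤ C|α| (1+z²)^{m/2} e^{-z²/4}. -/
open MeasureTheory Real Filter

/-- The error function `erf(x) = (2/√π) ∫_0^x e^{-s²} ds`. -/
noncomputable def erf (x : ℝ) : ℝ := 2 / Real.sqrt π * ∫ s in (0:ℝ)..x, Real.exp (-s^2)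

/-- The Burgers profile `g₀(z) = T e^{-z²/4} / (γ √π (1 + T·erf(z/2)))` with `T = tanh(αγ/2)`. -/
noncomputable def g0 (α γ : ℝ) (z : ℝ) : ℝ :=
  Real.tanh (α * γ / 2) * Real.exp (-z^2/4) /
    (γ * Real.sqrt π * (1 + Real.tanh (α * γ / 2) * erf (z/2)))


lemma aux_erf_bound (x : ℝ) : |erf x| ≤ 2 := by
  have hint : Integrable (fun s : ℝ => Real.exp (-s^2)) := by
    simpa using integrable_exp_neg_mul_sq (b := 1) one_pos
  have hval : ∫ s : ℝ, Real.exp (-s^2) = Real.sqrt π := by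
    simpa using integral_gaussian 1
  have h1 : |∫ s in (0:ℝ)..x, Real.exp (-s^2)| ≤ Real.sqrt π := by
    have h := intervalIntegral.norm_integral_le_integral_norm_uIoc
      (f := fun s : ℝ => Real.exp (-s^2)) (a := 0) (b := x) (μ := volume)
    rw [Real.norm_eq_abs] at h
    refine h.trans ?_
    rw [← hval]
    simp only [Real.norm_eq_abs, abs_of_pos (Real.exp_pos _)]
    exact setIntegral_le_integral hint (Eventually.of_forall fun s => (Real.exp_pos _).le)
  have hp : 0 < Real.sqrt π := Real.sqrt_pos.2 Real.pi_pos
  unfold erf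
  rw [abs_mul, abs_of_pos (by positivity)]
  calc 2 / Real.sqrt π * |∫ s in (0:ℝ)..x, Real.exp (-s^2)|
      ≤ 2 / Real.sqrt π * Real.sqrt π := by gcongr
    _ = 2 := by field_simp

lemma aux_erf_deriv (x : ℝ) : HasDerivAt erf (2 / Real.sqrt π * Real.exp (-x^2)) x := by
  have hc : Continuous (fun s : ℝ => Real.exp (-s^2)) := by fun_prop
  exact (intervalIntegral.integral_hasDerivAt_right (hc.intervalIntegrable _ _)
    (hc.stronglyMeasurableAtFilter _ _) hc.continuousAt).const_mul _

lemma aux_tanh_deriv (x : ℝ) : HasDerivAt Real.tanh (1 / Real.cosh x ^ 2) x := by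
  have h := (Real.hasDerivAt_sinh x).div (Real.hasDerivAt_cosh x) (Real.cosh_pos x).ne'
  have e : (Real.sinh / Real.cosh : ℝ → ℝ) = Real.tanh := by
    ext y; simp [Real.tanh_eq_sinh_div_cosh]
  rw [e] at h
  refine h.congr_deriv ?_
  congr 1
  have := Real.cosh_sq x
  linarith [this, sq (Real.cosh x), sq (Real.sinh x)]

lemma aux_tanh (x : ℝ) : |Real.tanh x| ≤ |x| := by
  have := Convex.norm_image_sub_le_of_norm_hasDerivWithin_le (s := Set.univ) (C := 1)
    (f := Real.tanh) (x := 0) (y := x)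
    (fun y _ => (aux_tanh_deriv y).hasDerivWithinAt) (fun y _ => by
      rw [Real.norm_eq_abs, abs_of_nonneg (by positivity)]
      exact (div_le_one (by have := Real.cosh_pos y; positivity)).2
        (one_le_pow₀ (Real.one_le_cosh y))) convex_univ (Set.mem_univ _) (Set.mem_univ _)
  simpa using this

lemma aux_den (α γ : ℝ) (h : |α * γ| ≤ 1/2) (z : ℝ) :
    1/2 ≤ 1 + Real.tanh (α * γ / 2) * erf (z/2) := by
  have h1 : |Real.tanh (α * γ / 2)| ≤ 1/4 := by
    refine (aux_tanh _).trans ?_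
    rw [abs_div, abs_two]; linarith
  have h2 : |Real.tanh (α * γ / 2) * erf (z/2)| ≤ 1/4 * 2 := by
    rw [abs_mul]
    exact mul_le_mul h1 (aux_erf_bound _) (abs_nonneg _) (by norm_num)
  linarith [(abs_le.1 h2).1]

lemma aux_sqrt : 1 ≤ Real.sqrt π := by
  rw [Real.one_le_sqrt]; linarith [Real.pi_gt_three]

lemma aux_g0_bound (α γ : ℝ) (hγ : γ ≠ 0) (h : |α * γ| ≤ 1/2) (z : ℝ) :
    |g0 α γ z| ≤ |α| * Real.exp (-z^2/4) := by
  have hd := aux_den α γ h z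
  have hs := aux_sqrt
  have ht := aux_tanh (α * γ / 2)
  have hg : 0 < |γ| := abs_pos.2 hγ
  rw [abs_div, abs_mul, abs_two] at ht
  unfold g0
  rw [abs_div, abs_mul, abs_mul, abs_mul, abs_of_pos (Real.exp_pos _),
    abs_of_pos (show 0 < Real.sqrt π by linarith),
    abs_of_pos (show 0 < 1 + Real.tanh (α * γ / 2) * erf (z/2) by linarith)]
  rw [div_le_iff₀ (by positivity)]
  have h3 : 1 * (1/2) ≤ Real.sqrt π * (1 + Real.tanh (α * γ / 2) * erf (z/2)) :=
    mul_le_mul hs hd (by norm_num) (by linarith)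
  calc _ ≤ |α| * |γ| / 2 * Real.exp (-z^2/4) := by gcongr
    _ = |α| * Real.exp (-z^2/4) * (|γ| * (1 * (1/2))) := by ring
    _ ≤ |α| * Real.exp (-z^2/4) * (|γ| * (Real.sqrt π * (1 + Real.tanh (α * γ / 2) * erf (z/2)))) := by
      gcongr
    _ = _ := by ring

lemma aux_g0_deriv (α γ : ℝ) (hγ : γ ≠ 0) (h : |α * γ| ≤ 1/2) (z : ℝ) :
    HasDerivAt (g0 α γ) (-(z/2 + γ * g0 α γ z) * g0 α γ z) z := by
  have hd := aux_den α γ h z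
  have hs := aux_sqrt
  have hs' : Real.sqrt π ≠ 0 := by positivity
  have hd' : 1 + Real.tanh (α * γ / 2) * erf (z/2) ≠ 0 := by linarith
  have hz : HasDerivAt (fun z : ℝ => z / 2) (1/2) z := (hasDerivAt_id z).div_const 2
  have he : HasDerivAt (fun z : ℝ => erf (z/2)) (2 / Real.sqrt π * Real.exp (-(z/2)^2) * (1/2)) z :=
    HasDerivAt.comp (h₂ := erf) z (aux_erf_deriv (z/2)) hz
  have hq : HasDerivAt (fun z : ℝ => -z^2/4) (-z/2) z := by
    have := ((hasDerivAt_pow 2 z).neg).div_const 4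
    refine this.congr_deriv ?_
    norm_num; ring
  have hn := hq.exp.const_mul (Real.tanh (α * γ / 2))
  have hD := ((he.const_mul (Real.tanh (α * γ / 2))).const_add 1).const_mul (γ * Real.sqrt π)
  have := hn.div hD (by positivity)
  refine this.congr_deriv ?_
  have e : -(z/2)^2 = -z^2/4 := by ring
  rw [e]
  unfold g0
  field_simp
  ring

theorem stmt_9 :
    ∃ δ : ℝ, 0 < δ ∧ ∃ C : ℝ, 0 < C ∧
      ∀ α γ : ℝ, γ ≠ 0 → |α * γ| ≤ δ →
        ∀ m : ℕ, m ≤ 3 → ∀ z : ℝ,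
          |iteratedDeriv m (g0 α γ) z| ≤
            C * |α| * (1 + z^2) ^ ((m:ℝ)/2) * Real.exp (-z^2/4) := by
  refine ⟨1/2, by norm_num, 100, by norm_num, ?_⟩
  intro α γ hγ h m hm z
  have hD := aux_g0_deriv α γ hγ h
  have hB := aux_g0_bound α γ hγ h z
  set g := g0 α γ with hg
  have hh : |γ * g z| ≤ 1 := by
    rw [abs_mul]
    have : Real.exp (-z^2/4) ≤ 1 := by
      rw [Real.exp_le_one_iff]; nlinarith [sq_nonneg z]
    calc |γ| * |g z| ≤ |γ| * (|α| * 1) := by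
          refine mul_le_mul_of_nonneg_left (hB.trans ?_) (abs_nonneg _)
          gcongr
      _ = |α * γ| := by rw [abs_mul]; ring
      _ ≤ 1 := by linarith
  have d1 : deriv g = fun z => -(z/2 + γ * g z) * g z := funext fun z => (hD z).deriv
  have d2 : deriv (fun z => -(z/2 + γ * g z) * g z) =
      fun z => (-(1/2) + z^2/4 + 3/2 * z * (γ * g z) + 2 * (γ * g z)^2) * g z := by
    funext z
    have := (((((hasDerivAt_id z).div_const 2).add ((hD z).const_mul γ)).neg).mul (hD z)).deriv
    refine Eq.trans this ?_
    simp
    ring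
  have d3 : deriv (fun z => (-(1/2) + z^2/4 + 3/2 * z * (γ * g z) + 2 * (γ * g z)^2) * g z) =
      fun z => (z/2 + 3/2 * (γ * g z) + (3/2 * z + 4 * (γ * g z)) * (-(z/2 + γ * g z) * (γ * g z))
        + (-(1/2) + z^2/4 + 3/2 * z * (γ * g z) + 2 * (γ * g z)^2) * (-(z/2 + γ * g z))) * g z := by
    funext z
    have hgz := (hD z).const_mul γ
    have := ((((((hasDerivAt_pow 2 z).div_const 4).const_add (-(1/2))).add
      (((hasDerivAt_id z).const_mul (3/2)).mul hgz)).add ((hgz.pow 2).const_mul 2)).mul (hD z)).deriv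
    refine Eq.trans this ?_
    simp
    ring
  obtain ⟨w, hw, hw1, hzw⟩ : ∃ w : ℝ, w = Real.sqrt (1 + z^2) ∧ 1 ≤ w ∧ |z| ≤ w :=
    ⟨_, rfl, by rw [Real.one_le_sqrt]; nlinarith [sq_nonneg z], Real.abs_le_sqrt (by linarith)⟩
  have hpow : (1 + z^2) ^ ((m:ℝ)/2) = w ^ m := by
    rw [hw, Real.sqrt_eq_rpow, ← Real.rpow_natCast _ m, ← Real.rpow_mul (by positivity)]
    congr 1; ring
  rw [hpow]
  have key : ∀ P : ℝ, |P| ≤ 100 * w ^ m →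
      |P * g z| ≤ 100 * |α| * w ^ m * Real.exp (-z^2/4) := by
    intro P hP
    rw [abs_mul]
    calc |P| * |g z| ≤ (100 * w ^ m) * (|α| * Real.exp (-z^2/4)) := by gcongr
      _ = _ := by ring
  generalize hu : γ * g z = u at hh
  have b1 : |-(z/2 + u)| ≤ 3/2 * w := by
    rw [abs_le] at *; constructor <;> linarith
  have hw2 : w ≤ w^2 := by nlinarith
  have hw3 : w^2 ≤ w^3 := by nlinarith [sq_nonneg w]
  have bz2 : |z^2/4| ≤ w^2/4 := by
    rw [abs_of_nonneg (by positivity)]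
    have := sq_le_sq' (by linarith [(abs_le.1 hzw).1]) (abs_le.1 hzw).2
    linarith
  have bzu : |3/2 * z * u| ≤ 3/2 * w := by
    rw [abs_mul, abs_mul, abs_of_pos (by norm_num : (0:ℝ) < 3/2)]
    calc _ ≤ 3/2 * w * 1 := by gcongr
      _ = _ := by ring
  have bu2 : |2 * u^2| ≤ 2 := by
    rw [abs_mul, abs_pow, abs_two]
    have := pow_le_one₀ (n := 2) (abs_nonneg u) hh
    linarith
  have b2 : |-(1/2) + z^2/4 + 3/2 * z * u + 2 * u^2| ≤ 5 * w^2 := by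
    rw [abs_le] at bz2 bzu bu2 ⊢; constructor <;> linarith
  have b3 : |(3/2 * z + 4 * u) * (-(z/2 + u) * u)| ≤ 9 * w^2 := by
    have c1 : |3/2 * z + 4 * u| ≤ 6 * w := by
      rw [abs_le] at *; constructor <;> linarith
    rw [abs_mul, abs_mul]
    calc _ ≤ (6 * w) * ((3/2 * w) * 1) := by gcongr
      _ = _ := by ring
  have b4 : |(-(1/2) + z^2/4 + 3/2 * z * u + 2 * u^2) * (-(z/2 + u))| ≤ 15/2 * w^3 := by
    rw [abs_mul]
    calc _ ≤ (5 * w^2) * (3/2 * w) := by gcongr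
      _ = _ := by ring
  interval_cases m
  · have := key 1 (by norm_num)
    simpa using this
  · rw [iteratedDeriv_one, d1]
    simp only [hu]
    exact key _ (by rw [pow_one]; linarith)
  · rw [iteratedDeriv_succ, iteratedDeriv_one, d1, d2]
    simp only [hu]
    exact key _ (by linarith)
  · rw [iteratedDeriv_succ, iteratedDeriv_succ, iteratedDeriv_one, d1, d2, d3]
    simp only [hu]
    refine key _ ?_
    rw [abs_le] at hzw hh b3 b4 ⊢
    constructor <;> linarith
end
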